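/- arXiv:1308.2859 — 2 statements merged into one kernel-verified Lean document; each statement's English description precedes it below -/
import Mathlib

section
/- For 0 < q < 1 and n ∈ ℕ, the Wall polynomial satisfies the two equivalent representations: p_n(x;a;q) := ₂φ₁(q^{-n}, 0; aq; q, qx) = ((-1)^n q^{n(n+1)/2} (ax)^n / (aq;q)_n) · ₃φ₂(q^{-n}, q^{-n}/a, 1/x; 0, 0; q, q), where ₂φ₁ and ₃φ₂ are basic hypergeometric series. -/
/-- The finite q-shifted factorial `(a;q)_k` over `ℂ`. -/
noncomputable def qpC (q a : ℂ) (k : ℕ) : ℂ := ∏ i ∈ Finset.range k, (1 - a * q ^ i)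

/-- The infinite q-shifted factorial `(a;q)_∞` over `ℂ`. -/
noncomputable def qpInfC (q a : ℂ) : ℂ := ∏' i : ℕ, (1 - a * q ^ i)

/-- The Wall polynomial `p_n(x;a;q) = ₂φ₁(q^{-n},0;aq;q,qx)` over `ℂ`. -/
noncomputable def wallC (n : ℕ) (x a q : ℂ) : ℂ :=
  ∑ j ∈ Finset.range (n + 1),
    qpC q (q ^ (-(n : ℤ))) j / (qpC q (a * q) j * qpC q q j) * (q * x) ^ j

/-- The finite product `∏_{i<k} (q^n - q^i) / (1 - q^{i+1})`, which equals
`q^{nk} (q^{-n};q)_k / (q;q)_k`. -/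
noncomputable def qWeight (q : ℂ) (n k : ℕ) : ℂ :=
  ∏ i ∈ Finset.range k, (q ^ n - q ^ i) / (1 - q ^ (i + 1))

theorem pow_mul_prod_range (c : ℂ) (f : ℕ → ℂ) (k : ℕ) :
    c ^ k * ∏ i ∈ Finset.range k, f i = ∏ i ∈ Finset.range k, c * f i := by
  rw [Finset.prod_mul_distrib, Finset.prod_const, Finset.card_range]

theorem qpC_succ (q a : ℂ) (k : ℕ) : qpC q a (k + 1) = qpC q a k * (1 - a * q ^ k) :=
  Finset.prod_range_succ _ _

theorem qpC_succ_left (q a : ℂ) (k : ℕ) : qpC q a (k + 1) = (1 - a) * qpC q (a * q) k := by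
  simp only [qpC, Finset.prod_range_succ', pow_zero, mul_one]
  rw [mul_comm]
  congr 1
  exact Finset.prod_congr rfl fun i _ => by ring

theorem qpC_add (q a : ℂ) (m k : ℕ) : qpC q a (m + k) = qpC q a m * qpC q (a * q ^ m) k := by
  simp only [qpC, Finset.prod_range_add]
  congr 1
  exact Finset.prod_congr rfl fun i _ => by ring

theorem qpC_self_ne_zero {q : ℂ} (hq : ∀ i : ℕ, 1 - q ^ (i + 1) ≠ 0) (k : ℕ) : qpC q q k ≠ 0 :=
  Finset.prod_ne_zero_iff.2 fun i _ => by rw [← pow_succ']; exact hq i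

theorem qWeight_mul_qpC {q : ℂ} (hq : ∀ i : ℕ, 1 - q ^ (i + 1) ≠ 0) (n k : ℕ) :
    qWeight q n k * qpC q q k = ∏ i ∈ Finset.range k, (q ^ n - q ^ i) := by
  rw [qWeight, qpC, ← Finset.prod_mul_distrib]
  refine Finset.prod_congr rfl fun i _ => ?_
  rw [← pow_succ', div_mul_cancel₀ _ (hq i)]

theorem qWeight_self_succ (q : ℂ) (n : ℕ) : qWeight q n (n + 1) = 0 := by
  simp [qWeight, Finset.prod_range_succ]

theorem prod_pow_succ_sub_pow (q : ℂ) (n k : ℕ) :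
    ∏ i ∈ Finset.range (k + 1), (q ^ (n + 1) - q ^ i) =
      (q ^ (n + 1) - 1) * (q ^ k * ∏ i ∈ Finset.range k, (q ^ n - q ^ i)) := by
  rw [Finset.prod_range_succ', pow_zero, mul_comm]
  congr 1
  rw [pow_mul_prod_range]
  exact Finset.prod_congr rfl fun i _ => by ring

theorem qWeight_succ_succ {q : ℂ} (hq : ∀ i : ℕ, 1 - q ^ (i + 1) ≠ 0) (n k : ℕ) :
    qWeight q (n + 1) (k + 1) = q ^ (k + 1) * qWeight q n (k + 1) - q ^ k * qWeight q n k := by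
  have h := hq k
  have hk := qpC_self_ne_zero hq k
  have h1 := qWeight_mul_qpC hq (n + 1) (k + 1)
  have h2 := qWeight_mul_qpC hq n k
  have h3 : qWeight q n (k + 1) * (1 - q ^ (k + 1)) = qWeight q n k * (q ^ n - q ^ k) := by
    rw [qWeight, Finset.prod_range_succ, mul_assoc, div_mul_cancel₀ _ h, qWeight]
  rw [prod_pow_succ_sub_pow, ← h2, qpC_succ, ← pow_succ'] at h1
  apply mul_right_cancel₀ (mul_ne_zero hk h)
  linear_combination h1 - q ^ (k + 1) * qpC q q k * h3

theorem sum_qWeight_succ {q : ℂ} (hq : ∀ i : ℕ, 1 - q ^ (i + 1) ≠ 0) (n : ℕ) (f : ℕ → ℂ) :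
    ∑ k ∈ Finset.range (n + 2), qWeight q (n + 1) k * f k =
      ∑ k ∈ Finset.range (n + 1), qWeight q n k * (q ^ k * (f k - f (k + 1))) := by
  have h : ∑ k ∈ Finset.range (n + 1), qWeight q n k * (q ^ k * f k) =
      ∑ k ∈ Finset.range (n + 1), q ^ (k + 1) * qWeight q n (k + 1) * f (k + 1) + f 0 := by
    have h := Finset.sum_range_succ (fun k => qWeight q n k * (q ^ k * f k)) (n + 1)
    rw [qWeight_self_succ, zero_mul, add_zero] at h
    rw [← h, Finset.sum_range_succ']
    congr 1
    · exact Finset.sum_congr rfl fun i _ => by ring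
    · simp [qWeight]
  simp only [mul_sub, Finset.sum_sub_distrib]
  rw [h, Finset.sum_range_succ']
  simp only [qWeight_succ_succ hq, sub_mul, Finset.sum_sub_distrib]
  have h0 : qWeight q (n + 1) 0 = 1 := by simp [qWeight]
  rw [h0, one_mul, sub_add_eq_add_sub]
  congr 1
  exact Finset.sum_congr rfl fun i _ => by ring

/-- A transformation of terminating sums whose right-hand side is symmetric in `a` and `y`. -/
theorem sum_qWeight_transformation {q : ℂ} (hq : ∀ i : ℕ, 1 - q ^ (i + 1) ≠ 0) (n : ℕ) (a y : ℂ) :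
    ∑ j ∈ Finset.range (n + 1),
        qWeight q n j * ((q * y) ^ j * qpC q (a * q ^ (j + 1)) (n - j)) =
      ∑ m ∈ Finset.range (n + 1), qWeight q n m * (q ^ (m ^ 2 + m) * (a * y) ^ m *
        qpC q (a * q ^ (m + 1)) (n - m) * qpC q (y * q ^ (m + 1)) (n - m)) := by
  induction n generalizing a y with
  | zero => simp [qpC]
  | succ n ih =>
    rw [sum_qWeight_succ hq, sum_qWeight_succ hq]
    have hL : ∑ k ∈ Finset.range (n + 1), qWeight q n k * (q ^ k *
        ((q * y) ^ k * qpC q (a * q ^ (k + 1)) (n + 1 - k) -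
          (q * y) ^ (k + 1) * qpC q (a * q ^ (k + 1 + 1)) (n + 1 - (k + 1)))) =
        (1 - a * q ^ (n + 1)) * ∑ j ∈ Finset.range (n + 1),
          qWeight q n j * ((q * (q * y)) ^ j * qpC q (a * q ^ (j + 1)) (n - j)) -
        y * q * ∑ j ∈ Finset.range (n + 1),
          qWeight q n j * ((q * (q * y)) ^ j * qpC q (a * q * q ^ (j + 1)) (n - j)) := by
      rw [Finset.mul_sum, Finset.mul_sum, ← Finset.sum_sub_distrib]
      refine Finset.sum_congr rfl fun k hk => ?_
      obtain ⟨l, rfl⟩ := Nat.exists_eq_add_of_le (Nat.lt_succ_iff.1 (Finset.mem_range.1 hk))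
      rw [show k + l + 1 - k = l + 1 by lia, show k + l + 1 - (k + 1) = l by lia,
        show k + l - k = l by lia, qpC_succ,
        show a * q * q ^ (k + 1) = a * q ^ (k + 1 + 1) by ring]
      ring
    rw [hL, ih, ih, Finset.mul_sum, Finset.mul_sum, ← Finset.sum_sub_distrib]
    refine Finset.sum_congr rfl fun k hk => ?_
    obtain ⟨l, rfl⟩ := Nat.exists_eq_add_of_le (Nat.lt_succ_iff.1 (Finset.mem_range.1 hk))
    rw [show k + l + 1 - k = l + 1 by lia, show k + l + 1 - (k + 1) = l by lia,
      show k + l - k = l by lia, qpC_succ_left q (y * q ^ (k + 1)),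
      show a * q * q ^ (k + 1) = a * q ^ (k + 1 + 1) by ring,
      show q * y * q ^ (k + 1) = y * q ^ (k + 1 + 1) by ring,
      show y * q ^ (k + 1) * q = y * q ^ (k + 1 + 1) by ring]
    have h1 := qpC_succ q (a * q ^ (k + 1)) l
    have h2 := qpC_succ_left q (a * q ^ (k + 1)) l
    rw [show a * q ^ (k + 1) * q = a * q ^ (k + 1 + 1) by ring] at h2
    have h3 : (1 - a * q ^ (k + l + 1)) * qpC q (a * q ^ (k + 1)) l =
        (1 - a * q ^ (k + 1)) * qpC q (a * q ^ (k + 1 + 1)) l := by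
      rw [← h2, h1]; ring
    rw [h2]
    linear_combination (qWeight q (k + l) k * q ^ (k ^ 2 + k) * (a * (q * y)) ^ k *
      qpC q (y * q ^ (k + 1 + 1)) l) * h3

theorem prod_pow_sub_mul_pow (q c : ℂ) (k : ℕ) :
    ∏ i ∈ Finset.range k, (q ^ i - c * q ^ k) = q ^ k.choose 2 * qpC q (c * q) k := by
  induction k with
  | zero => simp [qpC]
  | succ k ih =>
    have h : ∏ i ∈ Finset.range k, (q ^ (i + 1) - c * q ^ (k + 1)) =
        q ^ k * ∏ i ∈ Finset.range k, (q ^ i - c * q ^ k) := by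
      rw [pow_mul_prod_range]
      exact Finset.prod_congr rfl fun i _ => by ring
    rw [Finset.prod_range_succ', h, ih, qpC_succ, Nat.choose_succ_succ' k 1, Nat.choose_one_right]
    ring

theorem qWeight_add_mul_qpC {q : ℂ} (hq : ∀ i : ℕ, 1 - q ^ (i + 1) ≠ 0) (m k : ℕ) :
    qWeight q (m + k) k * (qpC q q m * qpC q q k) =
      (-1) ^ k * q ^ k.choose 2 * qpC q q (m + k) := by
  have h : ∏ i ∈ Finset.range k, (q ^ (m + k) - q ^ i) =
      (-1) ^ k * ∏ i ∈ Finset.range k, (q ^ i - q ^ m * q ^ k) := by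
    rw [pow_mul_prod_range]
    exact Finset.prod_congr rfl fun i _ => by ring
  rw [mul_left_comm, qWeight_mul_qpC hq, h, prod_pow_sub_mul_pow, qpC_add, mul_comm q (q ^ m)]
  ring

theorem choose_two_add_choose_two (m k : ℕ) :
    (m + k + 1).choose 2 + k.choose 2 = m.choose 2 + m + (m + k) * k := by
  induction k with
  | zero => simp [Nat.choose_succ_succ' m 1, add_comm]
  | succ k ih =>
    rw [← add_assoc, Nat.choose_succ_succ' (m + k + 1) 1, Nat.choose_succ_succ' k 1,
      Nat.choose_one_right, Nat.choose_one_right]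
    linear_combination ih

theorem qWeight_symm {q : ℂ} (hq : ∀ i : ℕ, 1 - q ^ (i + 1) ≠ 0) (m k : ℕ) :
    (-1) ^ (m + k) * q ^ (m + k + 1).choose 2 * qWeight q (m + k) k =
      qWeight q (m + k) m * q ^ (m + (m + k) * k) := by
  have h1 := qWeight_add_mul_qpC hq m k
  have h2 := qWeight_add_mul_qpC hq k m
  rw [add_comm k m] at h2
  have h3 : q ^ (m + k + 1).choose 2 * q ^ k.choose 2 =
      q ^ m.choose 2 * q ^ (m + (m + k) * k) := by
    rw [← pow_add, ← pow_add, choose_two_add_choose_two, add_assoc]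
  have h4 : (-1 : ℂ) ^ k * (-1) ^ k = 1 := by rw [← mul_pow]; simp
  apply mul_right_cancel₀ (mul_ne_zero (qpC_self_ne_zero hq m) (qpC_self_ne_zero hq k))
  linear_combination (-1) ^ (m + k) * q ^ (m + k + 1).choose 2 * h1 -
    q ^ (m + (m + k) * k) * h2 + (-1) ^ m * qpC q q (m + k) * h3 +
    (-1) ^ m * q ^ (m + k + 1).choose 2 * q ^ k.choose 2 * qpC q q (m + k) * h4

theorem qpC_inv_mul {q b : ℂ} (hq : q ≠ 0) (hb : b ≠ 0) (m k : ℕ) :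
    qpC q ((q ^ (m + k))⁻¹ / b) k * (b * q ^ (m + k)) ^ k =
      (-1) ^ k * q ^ k.choose 2 * qpC q (b * q ^ (m + 1)) k := by
  rw [show b * q ^ (m + 1) = b * q ^ m * q by ring, mul_assoc, ← prod_pow_sub_mul_pow, qpC]
  rw [mul_comm, pow_mul_prod_range, pow_mul_prod_range]
  refine Finset.prod_congr rfl fun i _ => ?_
  field_simp
  ring

theorem qpC_inv_pow {q : ℂ} (hq0 : q ≠ 0) (hq : ∀ i : ℕ, 1 - q ^ (i + 1) ≠ 0)
    (n k : ℕ) : qpC q (q ^ n)⁻¹ k = qWeight q n k * qpC q q k / (q ^ n) ^ k := by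
  rw [qWeight_mul_qpC hq, eq_div_iff (pow_ne_zero _ (pow_ne_zero _ hq0)), qpC]
  rw [mul_comm, pow_mul_prod_range]
  refine Finset.prod_congr rfl fun i _ => ?_
  field_simp

/-- the two equivalent representations of the Wall polynomial
`p_n(x;a;q) = ₂φ₁(q^{-n},0;aq;q,qx)
 = ((-1)^n q^{n(n+1)/2} (ax)^n / (aq;q)_n) ₃φ₂(q^{-n},q^{-n}/a,1/x;0,0;q,q)`. -/
theorem wall_two_representations (q : ℝ) (hq0 : 0 < q) (hq1 : q < 1) (n : ℕ) (a x : ℂ)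
    (ha : a ≠ 0) (hx : x ≠ 0) (haq : qpC (q : ℂ) (a * (q : ℂ)) n ≠ 0) :
    wallC n x a (q : ℂ) =
      (-1) ^ n * (q : ℂ) ^ (n * (n + 1) / 2) * (a * x) ^ n / qpC (q : ℂ) (a * (q : ℂ)) n *
        ∑ k ∈ Finset.range (n + 1),
          qpC (q : ℂ) ((q : ℂ) ^ (-(n : ℤ))) k * qpC (q : ℂ) ((q : ℂ) ^ (-(n : ℤ)) / a) k *
            qpC (q : ℂ) (1 / x) k * (q : ℂ) ^ k / qpC (q : ℂ) (q : ℂ) k := by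
  have hQ0 : (q : ℂ) ≠ 0 := by exact_mod_cast hq0.ne'
  have hQ : ∀ i : ℕ, 1 - (q : ℂ) ^ (i + 1) ≠ 0 := fun i => by
    have h : 1 - q ^ (i + 1) ≠ 0 := (sub_pos.2 (pow_lt_one₀ hq0.le hq1 i.succ_ne_zero)).ne'
    exact_mod_cast h
  generalize (q : ℂ) = Q at *
  obtain ⟨y, rfl⟩ : ∃ y, x = y * Q ^ n := ⟨x / Q ^ n, by field_simp⟩
  have hy : y ≠ 0 := left_ne_zero_of_mul hx
  have hT : n * (n + 1) / 2 = (n + 1).choose 2 := by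
    rw [Nat.choose_two_right, Nat.add_sub_cancel, mul_comm]
  rw [zpow_neg, zpow_natCast, div_mul_eq_mul_div, eq_div_iff haq, wallC, Finset.sum_mul,
    Finset.mul_sum, zpow_neg, zpow_natCast, hT]
  trans ∑ j ∈ Finset.range (n + 1),
      qWeight Q n j * ((Q * y) ^ j * qpC Q (a * Q ^ (j + 1)) (n - j))
  · refine Finset.sum_congr rfl fun j hj => ?_
    obtain ⟨l, rfl⟩ := Nat.exists_eq_add_of_le (Nat.lt_succ_iff.1 (Finset.mem_range.1 hj))
    rw [qpC_add, show a * Q * Q ^ j = a * Q ^ (j + 1) by ring] at haq ⊢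
    have h1 := left_ne_zero_of_mul haq
    have h2 := qpC_self_ne_zero hQ j
    rw [qpC_inv_pow hQ0 hQ, Nat.add_sub_cancel_left]
    field_simp
    ring
  rw [sum_qWeight_transformation hQ, ← Finset.sum_flip]
  refine Finset.sum_congr rfl fun k hk => ?_
  obtain ⟨m, rfl⟩ := Nat.exists_eq_add_of_le' (Nat.lt_succ_iff.1 (Finset.mem_range.1 hk))
  have h2 := qpC_self_ne_zero hQ k
  have hA := qpC_inv_mul hQ0 ha m k
  have hY := qpC_inv_mul hQ0 hy m k
  have hS := qWeight_symm hQ m k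
  rw [Nat.add_sub_cancel, Nat.add_sub_cancel_left,
    show 1 / (y * Q ^ (m + k)) = (Q ^ (m + k))⁻¹ / y by field_simp, qpC_inv_pow hQ0 hQ]
  have h4 : (-1 : ℂ) ^ k * (-1) ^ k = 1 := by rw [← mul_pow]; simp
  have hk : Q ^ k.choose 2 * Q ^ k.choose 2 * Q ^ k = Q ^ (k ^ 2) := by
    rw [← pow_add, ← pow_add]
    have h := choose_two_add_choose_two 0 k
    rw [zero_add, Nat.choose_succ_succ' k 1, Nat.choose_one_right] at h
    congr 1
    simp only [Nat.choose_zero_succ] at h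
    linear_combination h
  have hD : (a * Q ^ (m + k)) ^ k * (y * Q ^ (m + k)) ^ k * (Q ^ (m + k)) ^ k ≠ 0 := by
    positivity
  apply mul_right_cancel₀ hD
  calc
    _ = (qWeight Q (m + k) m * Q ^ (m + (m + k) * k)) * (a * (y * Q ^ (m + k))) ^ (m + k) *
          Q ^ (k ^ 2) * qpC Q (a * Q ^ (m + 1)) k * qpC Q (y * Q ^ (m + 1)) k := by ring
    _ = (-1) ^ (m + k) * Q ^ (m + k + 1).choose 2 * (a * (y * Q ^ (m + k))) ^ (m + k) *
          qWeight Q (m + k) k * Q ^ k *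
          (qpC Q ((Q ^ (m + k))⁻¹ / a) k * (a * Q ^ (m + k)) ^ k) *
          (qpC Q ((Q ^ (m + k))⁻¹ / y) k * (y * Q ^ (m + k)) ^ k) := by
      rw [hA, hY, ← hS, ← hk]
      linear_combination (-(-1) ^ (m + k) * Q ^ (m + k + 1).choose 2 *
        (a * (y * Q ^ (m + k))) ^ (m + k) * qWeight Q (m + k) k * Q ^ k * Q ^ k.choose 2 *
        Q ^ k.choose 2 * qpC Q (a * Q ^ (m + 1)) k * qpC Q (y * Q ^ (m + 1)) k) * h4
    _ = _ := by
      generalize qpC Q ((Q ^ (m + k))⁻¹ / a) k = A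
      generalize qpC Q ((Q ^ (m + k))⁻¹ / y) k = Y
      field_simp
end

section
/- For 0 < q < 1 and 0 < a < q^{-1}, the Wall polynomials p_n(x;a;q) satisfy the orthogonality relations Σ_{k=0}^∞ ((aq)^k/(q;q)_k) p_n(q^k;a;q) p_m(q^k;a;q) = δ_{nm} (aq)^n (q;q)_n / ((aq;q)_n (aq;q)_∞). -/
/-- The finite q-shifted factorial `(a;q)_k`. -/
noncomputable def qp (q a : ℝ) (k : ℕ) : ℝ := ∏ i ∈ Finset.range k, (1 - a * q ^ i)

/-- The infinite q-shifted factorial `(a;q)_∞`. -/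
noncomputable def qpInf (q a : ℝ) : ℝ := ∏' i : ℕ, (1 - a * q ^ i)

/-- The Wall polynomial `p_n(x;a;q) = ₂φ₁(q^{-n},0;aq;q,qx)` as a terminating sum. -/
noncomputable def wall (n : ℕ) (x a q : ℝ) : ℝ :=
  ∑ j ∈ Finset.range (n + 1), qp q (q ^ (-(n : ℤ))) j / (qp q (a * q) j * qp q q j) * (q * x) ^ j

open Filter Topology Finset

lemma qp_zero (q a : ℝ) : qp q a 0 = 1 := by simp [qp]

lemma qp_succ (q a : ℝ) (k : ℕ) : qp q a (k + 1) = qp q a k * (1 - a * q ^ k) :=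
  prod_range_succ _ _

lemma qp_add (q a : ℝ) (j s : ℕ) : qp q a (j + s) = qp q a j * qp q (a * q ^ j) s := by
  simp only [qp, prod_range_add, pow_add, mul_assoc]

lemma qp_succ_left (q a : ℝ) (k : ℕ) : qp q a (k + 1) = (1 - a) * qp q (a * q) k := by
  rw [add_comm, qp_add]
  simp [qp]

lemma qp_pos {q a : ℝ} (hq0 : 0 < q) (hq1 : q < 1) (ha : a < 1) (k : ℕ) : 0 < qp q a k := by
  refine prod_pos fun i _ => ?_
  have h0 : 0 < q ^ i := pow_pos hq0 i
  have h1 : q ^ i ≤ 1 := pow_le_one₀ hq0.le hq1.le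
  nlinarith

/-- The `q`-exponential series `∑ z^k / (q;q)_k`. -/
noncomputable def qExp (q z : ℝ) : ℝ := ∑' k : ℕ, z ^ k / qp q q k

lemma summable_qExp {q z : ℝ} (hq0 : 0 < q) (hq1 : q < 1) (hz0 : 0 < z) (hz1 : z < 1) :
    Summable fun k : ℕ => z ^ k / qp q q k := by
  refine summable_of_ratio_test_tendsto_lt_one hz1
    (Eventually.of_forall fun k => (div_pos (pow_pos hz0 k) (qp_pos hq0 hq1 hq1 k)).ne') ?_
  have hlim : Tendsto (fun k : ℕ => z / (1 - q * q ^ k)) atTop (𝓝 (z / (1 - q * 0))) :=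
    tendsto_const_nhds.div
      (((tendsto_pow_atTop_nhds_zero_of_lt_one hq0.le hq1).const_mul q).const_sub 1) (by simp)
  simp only [mul_zero, sub_zero, div_one] at hlim
  refine hlim.congr fun k => ?_
  have hk := qp_pos hq0 hq1 hq1 k
  have hk' := qp_pos hq0 hq1 hq1 (k + 1)
  rw [Real.norm_of_nonneg (by positivity), Real.norm_of_nonneg (by positivity)]
  rw [qp_succ] at hk' ⊢
  have := pos_of_mul_pos_right hk' hk.le
  field_simp
  ring

lemma qExp_mul_q {q z : ℝ} (hq0 : 0 < q) (hq1 : q < 1) (hz0 : 0 < z) (hz1 : z < 1) :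
    qExp q (z * q) = (1 - z) * qExp q z := by
  have hs := summable_qExp hq0 hq1 hz0 hz1
  have hs' := summable_qExp hq0 hq1 (mul_pos hz0 hq0) (by nlinarith : z * q < 1)
  have key : ∑' k : ℕ, (z ^ k / qp q q k - (z * q) ^ k / qp q q k) = z * qExp q z := by
    rw [(hs.sub hs').tsum_eq_zero_add, qExp, ← tsum_mul_left]
    simp only [pow_zero, sub_self, zero_add]
    refine tsum_congr fun k => ?_
    have hk := qp_pos hq0 hq1 hq1 k
    have hk' := qp_pos hq0 hq1 hq1 (k + 1)
    rw [qp_succ] at hk' ⊢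
    have := pos_of_mul_pos_right hk' hk.le
    field_simp
    ring
  rw [hs.tsum_sub hs'] at key
  simp only [qExp] at key ⊢
  linarith

lemma qExp_mul_pow {q z : ℝ} (hq0 : 0 < q) (hq1 : q < 1) (hz0 : 0 < z) (hz1 : z < 1) (N : ℕ) :
    qExp q (z * q ^ N) = qp q z N * qExp q z := by
  induction N with
  | zero => simp [qp_zero]
  | succ N ih =>
    have h1 : q ^ N ≤ 1 := pow_le_one₀ hq0.le hq1.le
    rw [pow_succ, ← mul_assoc, qExp_mul_q hq0 hq1 (by positivity) (by nlinarith), ih, qp_succ]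
    ring

/-- Euler's identity `(z;q)_∞ ∑ z^k / (q;q)_k = 1`. -/
lemma qpInf_mul_qExp {q z : ℝ} (hq0 : 0 < q) (hq1 : q < 1) (hz0 : 0 < z) (hz1 : z < 1) :
    qpInf q z * qExp q z = 1 := by
  have hprod : Tendsto (fun N => qp q z N) atTop (𝓝 (qpInf q z)) := by
    have hm : Multipliable fun i : ℕ => 1 + -(z * q ^ i) :=
      Real.multipliable_one_add_of_summable
        ((summable_geometric_of_lt_one hq0.le hq1).mul_left z).neg
    simp only [← sub_eq_add_neg] at hm
    exact hm.hasProd.tendsto_prod_nat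
  have hone : Tendsto (fun N : ℕ => qExp q (z * q ^ N)) atTop (𝓝 1) := by
    have h0 : ∑' k : ℕ, (if k = 0 then (1 : ℝ) else 0) = 1 := tsum_ite_eq 0 _
    rw [← h0]
    refine tendsto_tsum_of_dominated_convergence (summable_qExp hq0 hq1 hz0 hz1) ?_ ?_
    · intro k
      rcases k with _ | k
      · simp [qp_zero]
      · have hq := tendsto_pow_atTop_nhds_zero_of_lt_one hq0.le hq1
        simpa using ((hq.const_mul z).pow (k + 1)).div_const (qp q q (k + 1))
    · refine Eventually.of_forall fun N k => ?_
      have hk := qp_pos hq0 hq1 hq1 k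
      have h1 : q ^ N ≤ 1 := pow_le_one₀ hq0.le hq1.le
      rw [Real.norm_of_nonneg (by positivity)]
      gcongr
      nlinarith
  refine tendsto_nhds_unique (hprod.mul_const _) (hone.congr fun N => ?_)
  exact qExp_mul_pow hq0 hq1 hz0 hz1 N

/-- Moments of the Wall weight. -/
lemma hasSum_moment {q b : ℝ} (hq0 : 0 < q) (hq1 : q < 1) (hb0 : 0 < b) (hb1 : b < 1) (s : ℕ) :
    HasSum (fun k : ℕ => b ^ k / qp q q k * (q ^ k) ^ s) (qp q b s * qExp q b) := by
  have h1 : q ^ s ≤ 1 := pow_le_one₀ hq0.le hq1.le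
  rw [← qExp_mul_pow hq0 hq1 hb0 hb1, qExp]
  convert (summable_qExp hq0 hq1 (z := b * q ^ s) (by positivity) (by nlinarith)).hasSum using 1
  funext k
  ring

lemma qp_inv_pow_succ_self {q : ℝ} (hq0 : 0 < q) (n : ℕ) :
    qp q (q ^ (-(n : ℤ))) (n + 1) = 0 := by
  rw [qp_succ, zpow_neg, zpow_natCast, inv_mul_cancel₀ (by positivity)]
  simp

lemma qp_inv_pow_div_succ {q : ℝ} (hq0 : 0 < q) (hq1 : q < 1) (n j : ℕ) :
    qp q (q ^ (-((n + 1 : ℕ) : ℤ))) (j + 1) / qp q q (j + 1) =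
      qp q (q ^ (-(n : ℤ))) (j + 1) / qp q q (j + 1) -
        (q ^ (n + 1))⁻¹ * (qp q (q ^ (-(n : ℤ))) j / qp q q j) := by
  have hshift : q ^ (-((n + 1 : ℕ) : ℤ)) * q = q ^ (-(n : ℤ)) := by
    simp only [zpow_neg, zpow_natCast]
    field_simp
    ring
  rw [qp_succ_left, hshift, qp_succ q (q ^ (-(n : ℤ)))]
  have hk := qp_pos hq0 hq1 hq1 j
  have hk' := qp_pos hq0 hq1 hq1 (j + 1)
  rw [qp_succ] at hk' ⊢
  have := pos_of_mul_pos_right hk' hk.le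
  simp only [zpow_neg, zpow_natCast]
  field_simp
  ring

/-- The terminating `q`-binomial theorem. -/
lemma sum_qp_inv_pow_div {q : ℝ} (hq0 : 0 < q) (hq1 : q < 1) (n : ℕ) (z : ℝ) :
    ∑ j ∈ range (n + 1), qp q (q ^ (-(n : ℤ))) j / qp q q j * z ^ j =
      ∏ i ∈ range n, (1 - z * (q ^ (i + 1))⁻¹) := by
  induction n with
  | zero => simp [qp_zero]
  | succ n ih =>
    have hext : ∑ j ∈ range (n + 1 + 1), qp q (q ^ (-(n : ℤ))) j / qp q q j * z ^ j =
        ∏ i ∈ range n, (1 - z * (q ^ (i + 1))⁻¹) := by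
      rw [sum_range_succ, ih, qp_inv_pow_succ_self hq0]
      simp
    have hshift : ∑ j ∈ range (n + 1),
        (q ^ (n + 1))⁻¹ * (qp q (q ^ (-(n : ℤ))) j / qp q q j) * z ^ (j + 1) =
        (∏ i ∈ range n, (1 - z * (q ^ (i + 1))⁻¹)) * (z * (q ^ (n + 1))⁻¹) := by
      rw [← ih, sum_mul]
      refine sum_congr rfl fun j _ => ?_
      ring
    rw [sum_range_succ'] at hext ⊢
    simp only [qp_inv_pow_div_succ hq0 hq1, sub_mul, sum_sub_distrib]
    rw [hshift, prod_range_succ, mul_sub, mul_one]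
    simp only [qp_zero] at hext ⊢
    linarith

lemma sum_qp_inv_pow_div_of_lt {q : ℝ} (hq0 : 0 < q) (hq1 : q < 1) {n t : ℕ} (ht : t < n) :
    ∑ j ∈ range (n + 1), qp q (q ^ (-(n : ℤ))) j / qp q q j * (q ^ (t + 1)) ^ j = 0 := by
  rw [sum_qp_inv_pow_div hq0 hq1]
  refine prod_eq_zero (mem_range.2 ht) ?_
  rw [mul_inv_cancel₀ (by positivity), sub_self]

lemma sum_qp_inv_pow_div_self {q : ℝ} (hq0 : 0 < q) (hq1 : q < 1) (n : ℕ) :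
    ∑ j ∈ range (n + 1), qp q (q ^ (-(n : ℤ))) j / qp q q j * (q ^ (n + 1)) ^ j = qp q q n := by
  rw [sum_qp_inv_pow_div hq0 hq1, qp, ← prod_range_reflect]
  refine prod_congr rfl fun i hi => ?_
  obtain ⟨d, rfl⟩ := Nat.exists_eq_add_of_lt (mem_range.1 hi)
  have : i + d + 1 - 1 - i = d := by omega
  rw [this]
  field_simp
  ring

/-- The sum `∑ (q^{-n};q)_j / (q;q)_j q^{j(t+1)} (b q^j;q)_s`. -/
noncomputable def shiftedSum (q b : ℝ) (n s t : ℕ) : ℝ :=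
  ∑ j ∈ range (n + 1),
    qp q (q ^ (-(n : ℤ))) j / qp q q j * (q ^ (t + 1)) ^ j * qp q (b * q ^ j) s

lemma shiftedSum_zero (q b : ℝ) (n t : ℕ) : shiftedSum q b n 0 t =
    ∑ j ∈ range (n + 1), qp q (q ^ (-(n : ℤ))) j / qp q q j * (q ^ (t + 1)) ^ j := by
  simp [shiftedSum, qp_zero]

lemma shiftedSum_succ (q b : ℝ) (n s t : ℕ) : shiftedSum q b n (s + 1) t =
    shiftedSum q b n s t - b * q ^ s * shiftedSum q b n s (t + 1) := by
  simp only [shiftedSum, mul_sum, ← sum_sub_distrib, qp_succ]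
  refine sum_congr rfl fun j _ => ?_
  ring

lemma shiftedSum_of_lt {q : ℝ} (hq0 : 0 < q) (hq1 : q < 1) (b : ℝ) {n s t : ℕ}
    (h : s + t < n) : shiftedSum q b n s t = 0 := by
  induction s generalizing t with
  | zero => rw [shiftedSum_zero, sum_qp_inv_pow_div_of_lt hq0 hq1 (by omega)]
  | succ s ih => rw [shiftedSum_succ, ih (by omega), ih (by omega)]; simp

lemma shiftedSum_of_eq {q : ℝ} (hq0 : 0 < q) (hq1 : q < 1) (b : ℝ) {n s t : ℕ}
    (h : s + t = n) : shiftedSum q b n s t = (∏ i ∈ range s, (-(b * q ^ i))) * qp q q n := by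
  induction s generalizing t with
  | zero =>
    obtain rfl : t = n := by omega
    rw [shiftedSum_zero, sum_qp_inv_pow_div_self hq0 hq1]
    simp
  | succ s ih =>
    rw [shiftedSum_succ, shiftedSum_of_lt hq0 hq1 b (by omega), ih (by omega), prod_range_succ]
    ring

lemma hasSum_pow_mul_wall {q a : ℝ} (hq0 : 0 < q) (hq1 : q < 1) (hb0 : 0 < a * q)
    (hb1 : a * q < 1) (n s : ℕ) :
    HasSum (fun k : ℕ => (a * q) ^ k / qp q q k * (q ^ k) ^ s * wall n (q ^ k) a q)
      (shiftedSum q (a * q) n s 0 * qExp q (a * q)) := by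
  have h := hasSum_sum (s := range (n + 1)) fun j _ =>
    (hasSum_moment hq0 hq1 hb0 hb1 (j + s)).mul_left
      (qp q (q ^ (-(n : ℤ))) j / (qp q (a * q) j * qp q q j) * q ^ j)
  have hval : shiftedSum q (a * q) n s 0 * qExp q (a * q) = ∑ j ∈ range (n + 1),
      qp q (q ^ (-(n : ℤ))) j / (qp q (a * q) j * qp q q j) * q ^ j *
        (qp q (a * q) (j + s) * qExp q (a * q)) := by
    rw [shiftedSum, sum_mul]
    refine sum_congr rfl fun j _ => ?_
    have h1 := (qp_pos hq0 hq1 hb1 j).ne'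
    rw [qp_add, zero_add, pow_one]
    field_simp
  have hfun : (fun k : ℕ => (a * q) ^ k / qp q q k * (q ^ k) ^ s * wall n (q ^ k) a q) =
      fun k : ℕ => ∑ j ∈ range (n + 1),
        qp q (q ^ (-(n : ℤ))) j / (qp q (a * q) j * qp q q j) * q ^ j *
          ((a * q) ^ k / qp q q k * (q ^ k) ^ (j + s)) := by
    funext k
    rw [wall, mul_sum]
    refine sum_congr rfl fun j _ => ?_
    ring
  rwa [hfun, hval]

lemma qp_inv_pow_self_mul {q : ℝ} (hq0 : 0 < q) (b : ℝ) (n : ℕ) :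
    qp q (q ^ (-(n : ℤ))) n * q ^ n * ∏ i ∈ range n, (-(b * q ^ i)) = b ^ n * qp q q n := by
  have hrefl : qp q (q ^ (-(n : ℤ))) n = ∏ i ∈ range n, (1 - (q ^ (i + 1))⁻¹) := by
    rw [qp, ← prod_range_reflect]
    refine prod_congr rfl fun i hi => ?_
    obtain ⟨d, rfl⟩ := Nat.exists_eq_add_of_lt (mem_range.1 hi)
    have : i + d + 1 - 1 - i = d := by omega
    rw [this, zpow_neg, zpow_natCast]
    field_simp
    ring
  have hconst (c : ℝ) : c ^ n = ∏ _i ∈ range n, c := by simp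
  rw [hrefl, hconst q, hconst b, qp, ← prod_mul_distrib, ← prod_mul_distrib, ← prod_mul_distrib]
  refine prod_congr rfl fun i _ => ?_
  field_simp
  ring

lemma tsum_wall_mul_wall_of_le {q a : ℝ} (hq0 : 0 < q) (hq1 : q < 1) (hb0 : 0 < a * q)
    (hb1 : a * q < 1) {n m : ℕ} (hnm : n ≤ m) :
    ∑' k : ℕ, (a * q) ^ k / qp q q k * wall n (q ^ k) a q * wall m (q ^ k) a q =
      (if n = m then (1 : ℝ) else 0) *
        ((a * q) ^ n * qp q q n / (qp q (a * q) n * qpInf q (a * q))) := by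
  have h := hasSum_sum (s := range (n + 1)) fun j _ =>
    (hasSum_pow_mul_wall hq0 hq1 hb0 hb1 m j).mul_left
      (qp q (q ^ (-(n : ℤ))) j / (qp q (a * q) j * qp q q j) * q ^ j)
  have hfun : (fun k : ℕ => (a * q) ^ k / qp q q k * wall n (q ^ k) a q * wall m (q ^ k) a q) =
      fun k : ℕ => ∑ j ∈ range (n + 1),
        qp q (q ^ (-(n : ℤ))) j / (qp q (a * q) j * qp q q j) * q ^ j *
          ((a * q) ^ k / qp q q k * (q ^ k) ^ j * wall m (q ^ k) a q) := by
    funext k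
    rw [wall, mul_sum, sum_mul]
    refine sum_congr rfl fun j _ => ?_
    ring
  rw [hfun, h.tsum_eq, sum_range_succ, sum_eq_zero fun j hj => ?_, zero_add]
  · split_ifs with heq
    · subst heq
      have hE := qpInf_mul_qExp hq0 hq1 hb0 hb1
      have hI : qpInf q (a * q) ≠ 0 := left_ne_zero_of_mul_eq_one hE
      have h1 := (qp_pos hq0 hq1 hb1 n).ne'
      have h2 := (qp_pos hq0 hq1 hq1 n).ne'
      have h3 := qp_inv_pow_self_mul hq0 (a * q) n
      rw [shiftedSum_of_eq hq0 hq1 _ (add_zero n), eq_inv_of_mul_eq_one_right hE, one_mul, ← h3]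
      field_simp
    · rw [shiftedSum_of_lt hq0 hq1 _ (by omega)]
      simp
  · rw [shiftedSum_of_lt hq0 hq1 _ (by have := mem_range.1 hj; omega)]
    simp

/-- orthogonality relations for the Wall polynomials. -/
theorem wall_orthogonality (q a : ℝ) (hq0 : 0 < q) (hq1 : q < 1) (ha0 : 0 < a)
    (ha1 : a < q⁻¹) (n m : ℕ) :
    ∑' k : ℕ, (a * q) ^ k / qp q q k * wall n (q ^ k) a q * wall m (q ^ k) a q =
      (if n = m then (1 : ℝ) else 0) *
        ((a * q) ^ n * qp q q n / (qp q (a * q) n * qpInf q (a * q))) := by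
  have hb0 : 0 < a * q := mul_pos ha0 hq0
  have hb1 : a * q < 1 := by simpa [hq0.ne'] using mul_lt_mul_of_pos_right ha1 hq0
  rcases le_total n m with h | h
  · exact tsum_wall_mul_wall_of_le hq0 hq1 hb0 hb1 h
  · simp only [mul_right_comm _ (wall n _ a q)]
    rw [tsum_wall_mul_wall_of_le hq0 hq1 hb0 hb1 h]
    rcases eq_or_ne n m with rfl | hne
    · rfl
    · simp [hne, hne.symm]
end
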